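/- Let p : Y → X be a continuous map of compact Hausdorff spaces, let X' ⊆ X be a closed subset, Y' := p⁻¹(X'), and let Y'' ⊆ Y' be any closed subset. If C(Y,ℂ) is a finitely generated module over C(X,ℂ) (with action (ξ • f)(y) = ξ(p(y))·f(y)), then C(Y'',ℂ) is a finitely generated module over C(X',ℂ) (with action (ξ' • f'')(y) = ξ'(p(y))·f''(y) for y ∈ Y''). -/

import Mathlib

/-- `C(Y, ℂ)` as a module over `C(X, ℂ)` via `(ξ • f) y = ξ (p y) * f y`. -/
noncomputable def pullbackModule {X Y : Type*} [TopologicalSpace X] [TopologicalSpace Y]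
    (p : C(Y, X)) : Module C(X, ℂ) C(Y, ℂ) :=
  Module.compHom _ (ContinuousMap.compRightAlgHom ℂ ℂ p).toRingHom

/-- Restriction of complex-valued continuous functions to a closed subset of a normal space is
surjective. -/
theorem compRightAlgHom_restrict_surjective {X : Type*} [TopologicalSpace X] [NormalSpace X]
    {s : Set X} (hs : IsClosed s) :
    Function.Surjective
      (ContinuousMap.compRightAlgHom ℂ ℂ (⟨Subtype.val, continuous_subtype_val⟩ : C(s, X))) :=
  fun f => ContinuousMap.exists_restrict_eq hs f

/-- Finite generation of `C(Y, ℂ)` over `C(X, ℂ)` passes along a commutative square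
`p ∘ j = i ∘ q` in which pulling back along `j` is surjective. -/
theorem finite_pullbackModule_of_surjective {X Y X' Y' : Type*} [TopologicalSpace X]
    [TopologicalSpace Y] [TopologicalSpace X'] [TopologicalSpace Y']
    (p : C(Y, X)) (q : C(Y', X')) (i : C(X', X)) (j : C(Y', Y)) (h : p.comp j = i.comp q)
    (hj : Function.Surjective (ContinuousMap.compRightAlgHom ℂ ℂ j)) :
    letI := pullbackModule p
    letI := pullbackModule q
    Module.Finite C(X, ℂ) C(Y, ℂ) → Module.Finite C(X', ℂ) C(Y', ℂ) := by
  let := pullbackModule p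
  let := pullbackModule q
  intro hfin
  let σ : C(X, ℂ) →+* C(X', ℂ) := (ContinuousMap.compRightAlgHom ℂ ℂ i).toRingHom
  let φ : C(Y, ℂ) →ₛₗ[σ] C(Y', ℂ) :=
    { toFun := ContinuousMap.compRightAlgHom ℂ ℂ j
      map_add' := map_add _
      map_smul' := fun ξ f => ContinuousMap.ext fun y =>
        congrArg (fun x => ξ x * f (j y)) (DFunLike.congr_fun h y) }
  exact Module.Finite.of_surjective φ hj

/-- **Lemma.** Let `p : Y → X` be a continuous map of compact Hausdorff spaces, `X' ⊆ X`
closed, `Y' := p⁻¹(X')`, and `Y'' ⊆ Y'` any closed subset.  If `C(Y, ℂ)` is a finitely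
generated `C(X, ℂ)`-module, then `C(Y'', ℂ)` is a finitely generated `C(X', ℂ)`-module,
with action `(ξ' • f'') y = ξ' (p y) * f'' y` for `y ∈ Y''`. -/
theorem restriction_to_closed_subset_finitelyGenerated
    {X Y : Type*} [TopologicalSpace X] [TopologicalSpace Y]
    [CompactSpace X] [CompactSpace Y] [T2Space X] [T2Space Y]
    (p : C(Y, X)) (X' : Set X) (hX' : IsClosed X')
    (Y'' : Set Y) (hY''closed : IsClosed Y'') (hY'' : Y'' ⊆ ⇑p ⁻¹' X') :
    letI := pullbackModule p
    letI := pullbackModule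
      (⟨fun y : ↥Y'' => (⟨p y.1, hY'' y.2⟩ : ↥X'),
        (p.continuous.comp continuous_subtype_val).subtype_mk _⟩ : C(↥Y'', ↥X'))
    Module.Finite C(X, ℂ) C(Y, ℂ) → Module.Finite C(↥X', ℂ) C(↥Y'', ℂ) := by
  exact finite_pullbackModule_of_surjective p _ ⟨Subtype.val, continuous_subtype_val⟩
    ⟨Subtype.val, continuous_subtype_val⟩ rfl
    (compRightAlgHom_restrict_surjective hY''closed)
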